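/- Let x > 0, σ > 0, r > 0, T > 0. Let (Ω, F, (F_t), P) be a filtered probability space carrying a standard one-dimensional Brownian motion W: W is jointly measurable and adapted, W_0 = 0 almost surely, W has almost surely continuous sample paths, and for all 0 ≤ s ≤ t the increment W_t − W_s is independent of F_s and Gaussian with mean 0 and variance t − s. Define X_t = x·exp( (r − σ²/2)·t + σ·W_t ). Then e^{−rT} · E[ X_T − inf_{0 ≤ t ≤ T} X_t ] = x·Φ(a₁) − x·e^{−rT}·Φ(a₂) − x·(σ²/(2r))·( Φ(−a₁) − e^{−rT}·Φ(−a₃) ), where Φ is the standard normal cumulative distribution function, a₁ = (r + σ²/2)·T / (σ·√T), a₂ = a₁ − σ·√T, and a₃ = a₁ − (2r/σ)·√T. -/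

import Mathlib

open MeasureTheory ProbabilityTheory

/-- The standard normal cumulative distribution function. -/
noncomputable def stdNormalCDF (t : ℝ) : ℝ :=
  ((gaussianReal 0 1) (Set.Iic t)).toReal

open Filter Topology Set
open scoped NNReal ENNReal

lemma gaussianReal_real_Iic (m : ℝ) {v : ℝ≥0} (hv : v ≠ 0) (a : ℝ) :
    (gaussianReal m v).real (Iic a) = stdNormalCDF ((a - m) / √v) := by
  have hv' : 0 < √(v : ℝ) := Real.sqrt_pos.2 (by positivity)
  have h : gaussianReal m v = (gaussianReal 0 1).map (fun y => √v * y + m) := by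
    rw [show (fun y => √v * y + m) = (fun y => y + m) ∘ fun y => √v * y from rfl,
      ← Measure.map_map (by fun_prop) (by fun_prop), gaussianReal_map_const_mul, gaussianReal_map_add_const]
    congr 1
    · simp
    · ext; simp
  rw [h, map_measureReal_apply (by fun_prop) measurableSet_Iic, stdNormalCDF, ← measureReal_def]
  congr 1
  ext y
  simp only [mem_preimage, mem_Iic]
  rw [le_div_iff₀ hv', le_sub_iff_add_le, mul_comm]

lemma stdNormalCDF_neg (u : ℝ) : stdNormalCDF (-u) = 1 - stdNormalCDF u := by
  have h : (gaussianReal 0 1).map (fun y => -y) = gaussianReal 0 1 := by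
    rw [gaussianReal_map_neg, neg_zero]
  have : NullSingletonClass (gaussianReal 0 1) := nullSingletonClass_gaussianReal one_ne_zero
  rw [stdNormalCDF, stdNormalCDF, ← measureReal_def, ← measureReal_def,
    ← probReal_compl_eq_one_sub measurableSet_Iic]
  conv_lhs => rw [← h]
  rw [map_measureReal_apply (by fun_prop) measurableSet_Iic, compl_Iic]
  have : (fun y : ℝ => -y) ⁻¹' Iic (-u) = Ici u := by ext; simp
  rw [this]
  exact measureReal_congr Ioi_ae_eq_Ici.symm

lemma abs_stdNormalCDF_sub_le (u w : ℝ) : |stdNormalCDF u - stdNormalCDF w| ≤ |u - w| := by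
  wlog h : w ≤ u generalizing u w
  · rw [abs_sub_comm, abs_sub_comm u]
    exact this w u (le_of_not_ge h)
  have key : stdNormalCDF u - stdNormalCDF w = (gaussianReal 0 1).real (Ioc w u) := by
    rw [show Ioc w u = Iic u \ Iic w by ext; simp [and_comm],
      measureReal_sdiff (Iic_subset_Iic.2 h) measurableSet_Iic]
    rfl
  rw [key, abs_of_nonneg measureReal_nonneg, abs_of_nonneg (sub_nonneg.2 h), measureReal_def,
    gaussianReal_apply _ one_ne_zero]
  refine ENNReal.toReal_le_of_le_ofReal (sub_nonneg.2 h) ?_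
  calc ∫⁻ x in Ioc w u, gaussianPDF 0 1 x ≤ ∫⁻ x in Ioc w u, 1 := by
        refine lintegral_mono fun x => ?_
        rw [gaussianPDF, ENNReal.ofReal_le_one, gaussianPDFReal]
        refine mul_le_one₀ ?_ (Real.exp_pos _).le ?_
        · refine inv_le_one_of_one_le₀ ?_
          rw [Real.one_le_sqrt]
          simp only [NNReal.coe_one, mul_one]
          linarith [Real.pi_gt_three]
        · rw [Real.exp_le_one_iff]
          simp only [NNReal.coe_one]
          nlinarith [sq_nonneg (x - 0)]
    _ = ENNReal.ofReal (u - w) := by simp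

lemma setIntegral_Iic_exp_gaussianReal (m c : ℝ) {v : ℝ≥0} (hv : v ≠ 0) (a : ℝ) :
    ∫ y in Iic a, Real.exp (c * y) ∂gaussianReal m v =
      Real.exp (c * m + c ^ 2 * v / 2) * stdNormalCDF ((a - m - c * v) / √v) := by
  have hv' : (v : ℝ) ≠ 0 := by exact_mod_cast hv
  rw [show a - m - c * v = a - (m + c * v) by ring, ← gaussianReal_real_Iic _ hv,
    ← integral_indicator measurableSet_Iic, integral_gaussianReal_eq_integral_smul hv,
    measureReal_def, gaussianReal_apply_eq_integral _ hv,
    ENNReal.toReal_ofReal (integral_nonneg fun _ => gaussianPDFReal_nonneg _ _ _),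
    ← integral_const_mul, ← integral_indicator measurableSet_Iic]
  congr 1 with y
  by_cases hy : y ∈ Iic a
  · simp only [indicator_of_mem hy, smul_eq_mul, gaussianPDFReal]
    rw [mul_right_comm, mul_left_comm, mul_assoc, mul_comm (Real.exp _), mul_comm (Real.exp _),
      mul_assoc, ← Real.exp_add, ← Real.exp_add]
    congr 2
    field_simp
    ring
  · simp [indicator_of_notMem hy]

lemma integral_Ioi_exp_mul_measureReal_le {α : Type*} {_ : MeasurableSpace α} (μ : Measure α)
    [IsProbabilityMeasure μ] {f : α → ℝ} (hf : AEMeasurable f μ) (h0 : 0 ≤ᵐ[μ] f)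
    {c : ℝ} (hc : 0 < c) :
    ∫ b in Ioi (0 : ℝ), c * Real.exp (-(c * b)) * μ.real {a | b ≤ f a} =
      1 - ∫ a, Real.exp (-(c * f a)) ∂μ := by
  have hprim (y : ℝ) : ∫ t in (0 : ℝ)..y, c * Real.exp (-(c * t)) = 1 - Real.exp (-(c * y)) := by
    have hd (t : ℝ) : HasDerivAt (fun t => -Real.exp (-(c * t))) (c * Real.exp (-(c * t))) t := by
      have := (((hasDerivAt_id t).const_mul c).neg.exp).neg
      refine this.congr_deriv ?_
      simp [mul_comm]
    rw [intervalIntegral.integral_eq_sub_of_hasDerivAt (fun t _ => hd t)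
      (Continuous.intervalIntegrable (by fun_prop) _ _)]
    simp
    ring
  have hbd : ∀ᵐ a ∂μ, ‖Real.exp (-(c * f a))‖ ≤ 1 := by
    filter_upwards [h0] with a ha
    rw [Real.norm_eq_abs, Real.abs_exp, Real.exp_le_one_iff, neg_nonpos]
    exact mul_nonneg hc.le ha
  have hint : Integrable (fun a => Real.exp (-(c * f a))) μ :=
    Integrable.of_bound (by fun_prop) 1 hbd
  have key := lintegral_comp_eq_lintegral_meas_le_mul μ (g := fun t => c * Real.exp (-(c * t)))
    h0 hf (fun t _ => Continuous.intervalIntegrable (by fun_prop) _ _)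
    (ae_of_all _ fun t => by positivity)
  simp only [hprim] at key
  have hanti : Antitone fun b : ℝ => μ.real {a | b ≤ f a} := fun b b' hb =>
    measureReal_mono fun a (ha : b' ≤ f a) => hb.trans ha
  have hmeas : Measurable fun b : ℝ => c * Real.exp (-(c * b)) * μ.real {a | b ≤ f a} :=
    Measurable.mul (by fun_prop) hanti.measurable
  rw [integral_eq_lintegral_of_nonneg_ae (ae_of_all _ fun b => by positivity)
    hmeas.aestronglyMeasurable,
    show 1 - ∫ a, Real.exp (-(c * f a)) ∂μ = ∫ a, (1 - Real.exp (-(c * f a))) ∂μ by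
      rw [integral_sub (integrable_const _) hint]; simp,
    integral_eq_lintegral_of_nonneg_ae ?_ (by fun_prop), key]
  · congr 1
    refine lintegral_congr fun b => ?_
    rw [ENNReal.ofReal_mul (by positivity), ofReal_measureReal, mul_comm]
  · filter_upwards [hbd] with a ha
    rw [Real.norm_eq_abs, Real.abs_exp] at ha
    simpa using ha

lemma integral_exp_neg_mul_max_gaussianReal (m c : ℝ) {v : ℝ≥0} (hv : v ≠ 0) :
    ∫ y, Real.exp (-(c * max (-y) 0)) ∂gaussianReal m v =
      Real.exp (c * m + c ^ 2 * v / 2) * stdNormalCDF ((-m - c * v) / √v) +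
        stdNormalCDF (m / √v) := by
  have h1 (y : ℝ) : Real.exp (-(c * max (-y) 0)) =
      (Iic 0).indicator (fun y => Real.exp (c * y)) y + (1 - (Iic 0).indicator 1 y) := by
    by_cases hy : y ∈ Iic (0 : ℝ)
    · rw [max_eq_left (by simpa using hy)]
      simp [indicator_of_mem hy]
    · rw [max_eq_right (by simp at hy ⊢; exact hy.le)]
      simp [indicator_of_notMem hy]
  have h2 : Integrable ((Iic (0 : ℝ)).indicator (1 : ℝ → ℝ)) (gaussianReal m v) :=
    (integrable_const (1 : ℝ)).indicator measurableSet_Iic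
  have h3 := (integrable_exp_mul_gaussianReal (μ := m) (v := v) c).indicator
    (measurableSet_Iic (a := (0 : ℝ)))
  have h4 : Integrable (fun y => 1 - (Iic (0 : ℝ)).indicator (1 : ℝ → ℝ) y) (gaussianReal m v) :=
    (integrable_const _).sub h2
  simp_rw [h1]
  rw [integral_add h3 h4, integral_sub (integrable_const _) h2,
    integral_indicator measurableSet_Iic, integral_indicator_one measurableSet_Iic,
    setIntegral_Iic_exp_gaussianReal _ _ hv, gaussianReal_real_Iic _ hv]
  rw [show m / √v = - ((0 - m) / √v) by ring, stdNormalCDF_neg]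
  simp

/-- The function whose Gaussian averages give the probability that a Brownian motion with
drift `ν` becomes nonpositive. -/
noncomputable def reflPayoff (ν z : ℝ) : ℝ :=
  (Iic (0 : ℝ)).indicator (fun z => 1 + Real.exp (-2 * ν * z)) z

/-- The expectation of `reflPayoff` for a Brownian motion with drift `ν` at time `s` started
from `z`. -/
noncomputable def reflKernel (ν s z : ℝ) : ℝ :=
  ∫ y, reflPayoff ν (z + y) ∂gaussianReal (ν * s) s.toNNReal

lemma measurable_reflPayoff (ν : ℝ) : Measurable (reflPayoff ν) :=
  Measurable.indicator (by fun_prop) measurableSet_Iic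

lemma reflPayoff_nonneg (ν z : ℝ) : 0 ≤ reflPayoff ν z :=
  indicator_nonneg (fun _ _ => by positivity) _

lemma reflPayoff_le (ν z : ℝ) : reflPayoff ν z ≤ 1 + Real.exp (-2 * ν * z) :=
  indicator_le_self' (f := fun z => 1 + Real.exp (-2 * ν * z)) (fun _ _ => by positivity) z

lemma integrable_reflPayoff_add (ν z m : ℝ) (v : ℝ≥0) :
    Integrable (fun y => reflPayoff ν (z + y)) (gaussianReal m v) := by
  refine Integrable.mono' (g := fun y => 1 + Real.exp (-2 * ν * z) * Real.exp (-2 * ν * y))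
    ((integrable_const _).add ((integrable_exp_mul_gaussianReal _).const_mul _))
    ((measurable_reflPayoff ν).comp (measurable_const_add z)).aestronglyMeasurable
    (ae_of_all _ fun y => ?_)
  rw [Real.norm_of_nonneg (reflPayoff_nonneg _ _), ← Real.exp_add, ← mul_add]
  exact reflPayoff_le _ _

lemma measurable_reflKernel (ν s : ℝ) : Measurable (reflKernel ν s) := by
  have : StronglyMeasurable (Function.uncurry fun z y => reflPayoff ν (z + y)) :=
    ((measurable_reflPayoff ν).comp (measurable_fst.add measurable_snd)).stronglyMeasurable
  exact this.integral_prod_right.measurable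

lemma reflKernel_nonneg (ν s z : ℝ) : 0 ≤ reflKernel ν s z :=
  integral_nonneg fun _ => reflPayoff_nonneg _ _

lemma reflKernel_le (ν z : ℝ) {s : ℝ} (hs : 0 ≤ s) :
    reflKernel ν s z ≤ 1 + Real.exp (-2 * ν * z) := by
  have h1 := (integrable_exp_mul_gaussianReal (μ := ν * s) (v := s.toNNReal) (-2 * ν)).const_mul
    (Real.exp (-2 * ν * z))
  calc reflKernel ν s z
      ≤ ∫ y, (1 + Real.exp (-2 * ν * z) * Real.exp (-2 * ν * y))
          ∂gaussianReal (ν * s) s.toNNReal := by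
        refine integral_mono (integrable_reflPayoff_add _ _ _ _)
          ((integrable_const _).add h1) fun y => ?_
        simp only
        rw [← Real.exp_add, ← mul_add]
        exact reflPayoff_le _ _
    _ = 1 + Real.exp (-2 * ν * z) := by
        have h2 := congrFun (mgf_id_gaussianReal (μ := ν * s) (v := s.toNNReal)) (-2 * ν)
        rw [mgf] at h2
        simp only [id_eq, Real.coe_toNNReal s hs] at h2
        rw [integral_add (integrable_const _) h1, integral_const_mul, h2,
          show ν * s * (-2 * ν) + s * (-2 * ν) ^ 2 / 2 = 0 by ring]
        simp

lemma reflKernel_eq (ν z : ℝ) {s : ℝ} (hs : 0 < s) :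
    reflKernel ν s z = stdNormalCDF ((-z - ν * s) / √s) +
      Real.exp (-2 * ν * z) * stdNormalCDF ((-z + ν * s) / √s) := by
  have hv : s.toNNReal ≠ 0 := by simpa using hs
  have h1 (y : ℝ) : reflPayoff ν (z + y) = (Iic (-z)).indicator (fun y =>
      1 + Real.exp (-2 * ν * z) * Real.exp (-2 * ν * y)) y := by
    have : z + y ∈ Iic (0 : ℝ) ↔ y ∈ Iic (-z) := by
      simp only [mem_Iic]; constructor <;> intro <;> linarith
    by_cases hy : y ∈ Iic (-z)
    · rw [reflPayoff, indicator_of_mem (this.2 hy), indicator_of_mem hy, ← Real.exp_add,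
        ← mul_add]
    · rw [reflPayoff, indicator_of_notMem (this.not.2 hy), indicator_of_notMem hy]
  simp_rw [reflKernel, h1]
  rw [integral_indicator measurableSet_Iic, integral_add (integrable_const _)
    ((integrable_exp_mul_gaussianReal _).const_mul _).integrableOn, integral_const_mul,
    setIntegral_Iic_exp_gaussianReal _ _ hv, setIntegral_const, gaussianReal_real_Iic _ hv,
    Real.coe_toNNReal s hs.le,
    show -2 * ν * (ν * s) + (-2 * ν) ^ 2 * s / 2 = 0 by ring,
    show -z - ν * s - -2 * ν * s = -z + ν * s by ring]
  simp

lemma abs_reflKernel_sub_one_le (ν z : ℝ) {s : ℝ} (hs : 0 < s) :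
    |reflKernel ν s z - 1| ≤ 2 * |z| / √s + |Real.exp (-2 * ν * z) - 1| := by
  set E := Real.exp (-2 * ν * z)
  set a := stdNormalCDF ((-z - ν * s) / √s) with ha
  set b := stdNormalCDF ((-z + ν * s) / √s) with hb
  have hlip (w : ℝ) : |(-z + w) / √s - w / √s| = |z| / √s := by
    rw [← sub_div, abs_div, abs_of_nonneg (Real.sqrt_nonneg s)]
    congr 1
    rw [← abs_neg z]
    congr 1
    ring
  have h1 : |a - (1 - stdNormalCDF (ν * s / √s))| ≤ |z| / √s := by
    rw [← stdNormalCDF_neg, ha, ← hlip (-(ν * s))]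
    simpa [sub_eq_add_neg, neg_div] using abs_stdNormalCDF_sub_le ((-z - ν * s) / √s)
      (-(ν * s / √s))
  have h2 : |b - stdNormalCDF (ν * s / √s)| ≤ |z| / √s :=
    (abs_stdNormalCDF_sub_le _ _).trans (hlip _).le
  have h3 : |(E - 1) * b| ≤ |E - 1| := by
    have hb1 : |b| ≤ 1 := by
      rw [hb, stdNormalCDF, ← measureReal_def, abs_of_nonneg measureReal_nonneg]
      exact measureReal_le_one
    rw [abs_mul]
    exact mul_le_of_le_one_right (abs_nonneg _) hb1
  rw [reflKernel_eq ν z hs, show a + E * b - 1 = (a - (1 - stdNormalCDF (ν * s / √s))) +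
    (b - stdNormalCDF (ν * s / √s)) + (E - 1) * b by ring]
  refine (abs_add_three _ _ _).trans ?_
  rw [two_mul, add_div]
  gcongr

lemma Continuous.tendsto_inf'_grid_sInf {f : ℝ → ℝ} (hf : Continuous f) {T : ℝ} (hT : 0 < T) :
    Tendsto (fun n : ℕ => (Finset.range (n + 2)).inf' Finset.nonempty_range_add_one
      fun k => f (k * (T / (n + 1)))) atTop (𝓝 (sInf (f '' Icc 0 T))) := by
  obtain ⟨t, ht, hmin⟩ := isCompact_Icc.exists_isMinOn (nonempty_Icc.2 hT.le) hf.continuousOn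
  have hI : sInf (f '' Icc 0 T) = f t :=
    IsLeast.csInf_eq ⟨mem_image_of_mem f ht, by rintro _ ⟨u, hu, rfl⟩; exact hmin hu⟩
  rw [hI]
  have hd : Tendsto (fun n : ℕ => T / ((n : ℝ) + 1)) atTop (𝓝 0) :=
    tendsto_const_div_atTop_nhds_zero_nat T |>.comp (tendsto_add_atTop_nat 1) |>.congr
      fun n => by simp
  have hk : Tendsto (fun n : ℕ => (⌊t / (T / (n + 1))⌋₊ : ℝ) * (T / (n + 1))) atTop (𝓝 t) := by
    refine tendsto_of_tendsto_of_tendsto_of_le_of_le (g := fun n : ℕ => t - T / ((n : ℝ) + 1))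
      (h := fun _ => t) (by simpa using hd.const_sub t) tendsto_const_nhds (fun n => ?_)
      fun n => ?_
    · have hp : 0 < T / ((n : ℝ) + 1) := by positivity
      have := Nat.lt_floor_add_one (t / (T / (n + 1)))
      rw [div_lt_iff₀ hp] at this
      simp only
      linarith
    · have hp : 0 < T / ((n : ℝ) + 1) := by positivity
      have := Nat.floor_le (div_nonneg ht.1 hp.le)
      rwa [le_div_iff₀ hp] at this
  refine tendsto_of_tendsto_of_tendsto_of_le_of_le tendsto_const_nhds
    ((hf.tendsto t).comp hk) (fun n => ?_) fun n => ?_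
  · refine Finset.le_inf' _ _ fun k hk => hmin ⟨by positivity, ?_⟩
    have : (k : ℝ) ≤ n + 1 := by
      exact_mod_cast Nat.lt_succ_iff.1 (Finset.mem_range.1 hk)
    calc k * (T / (n + 1)) ≤ (n + 1) * (T / (n + 1)) := by gcongr
      _ = T := by field_simp
  · refine Finset.inf'_le (fun k : ℕ => f (k * (T / (n + 1)))) (Finset.mem_range.2 ?_)
    have hp : 0 < T / ((n : ℝ) + 1) := by positivity
    have : t / (T / (n + 1)) ≤ (n + 1 : ℕ) := by
      rw [div_le_iff₀ hp]
      push_cast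
      rw [mul_div_cancel₀ _ (by positivity)]
      exact ht.2
    exact Nat.lt_succ_of_le (Nat.floor_le_of_le this)

lemma Continuous.eventually_first_nonpos_grid {f : ℝ → ℝ} (hf : Continuous f) {T : ℝ}
    (hT : 0 < T) (h0 : 0 < f 0) (hfT : f T ≠ 0) :
    ∃ δ > 0, ∀ ε > 0, ∀ᶠ n : ℕ in atTop, ∀ k ≤ n + 1,
      (∀ j < k, 0 < f (j * (T / (n + 1)))) → f (k * (T / (n + 1))) ≤ 0 →
        -ε ≤ f (k * (T / (n + 1))) ∧ δ ≤ T - k * (T / (n + 1)) := by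
  have hd : Tendsto (fun n : ℕ => T / ((n : ℝ) + 1)) atTop (𝓝 0) :=
    tendsto_const_div_atTop_nhds_zero_nat T |>.comp (tendsto_add_atTop_nat 1) |>.congr
      fun n => by simp
  have hle {n k : ℕ} (hk : k ≤ n + 1) : k * (T / ((n : ℝ) + 1)) ≤ T := by
    have : (k : ℝ) ≤ n + 1 := by exact_mod_cast hk
    calc k * (T / (n + 1)) ≤ (n + 1) * (T / ((n : ℝ) + 1)) := by gcongr
      _ = T := by field_simp
  obtain ⟨δ, hδ, hsign⟩ : ∃ δ > 0, ∀ t ≤ T, T - t < δ → 0 < f t * f T := by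
    have : ∀ᶠ t in 𝓝 T, 0 < f t * f T :=
      (hf.mul continuous_const).continuousAt.eventually_const_lt (mul_self_pos.2 hfT)
    obtain ⟨δ, hδ, h⟩ := Metric.eventually_nhds_iff.1 this
    exact ⟨δ, hδ, fun t ht htd => h (by
      rw [Real.dist_eq, abs_sub_comm, abs_of_nonneg (sub_nonneg.2 ht)]; exact htd)⟩
  refine ⟨δ / 2, half_pos hδ, fun ε hε => ?_⟩
  have huc := (isCompact_Icc (a := (0 : ℝ)) (b := T)).uniformContinuousOn_of_continuous
    hf.continuousOn
  rw [Metric.uniformContinuousOn_iff] at huc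
  obtain ⟨η, hη, hcont⟩ := huc ε hε
  filter_upwards [hd.eventually_lt_const hη, hd.eventually_lt_const (half_pos hδ)] with
    n hn1 hn2 k hk hpos hneg
  have hp : 0 < T / ((n : ℝ) + 1) := by positivity
  obtain _ | j := k
  · simp at hneg
    exact absurd hneg (not_le.2 h0)
  have hj := hpos j (Nat.lt_succ_self j)
  have hjT := hle (n := n) (k := j) (by omega)
  have hkT := hle hk
  push_cast at hkT hneg ⊢
  have hstep : ((j : ℝ) + 1) * (T / (n + 1)) = j * (T / (n + 1)) + T / (n + 1) := by ring
  constructor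
  · have := hcont _ ⟨by positivity, hjT⟩ _ ⟨by positivity, hkT⟩ (by
      rw [hstep, dist_self_add_right, Real.norm_of_nonneg hp.le]; exact hn1)
    rw [Real.dist_eq] at this
    linarith [(abs_lt.1 this).2]
  · by_contra! hlt
    have hs1 := hsign _ hkT (by linarith)
    have hs2 := hsign _ hjT (by linarith)
    have : 0 < f T := pos_of_mul_pos_right hs2 hj.le
    nlinarith

lemma map_eq_gaussianReal_of_increments {Ω : Type*} {m0 : MeasurableSpace Ω}
    {P : Measure Ω} {W : ℝ → Ω → ℝ} (hW0 : ∀ᵐ ω ∂P, W 0 ω = 0)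
    (hgauss : ∀ s t : ℝ, 0 ≤ s → s ≤ t →
      Measure.map (fun ω => W t ω - W s ω) P = gaussianReal 0 ((t - s).toNNReal))
    {T : ℝ} (hT : 0 ≤ T) : P.map (W T) = gaussianReal 0 T.toNNReal := by
  have h := hgauss 0 T le_rfl hT
  rw [sub_zero] at h
  rw [← h]
  refine Measure.map_congr ?_
  filter_upwards [hW0] with ω h
  rw [h, sub_zero]

section BrownianMotion

variable {Ω : Type*} {m0 : MeasurableSpace Ω} {P : Measure Ω} [IsProbabilityMeasure P]
  {ℱ : Filtration ℝ m0} {W : ℝ → Ω → ℝ}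

lemma setIntegral_reflPayoff_eq_setIntegral_reflKernel (hadapted : Adapted ℱ W) {s t : ℝ}
    (hindep : Indep (MeasurableSpace.comap (fun ω => W t ω - W s ω) inferInstance) (ℱ s) P)
    (hgauss : Measure.map (fun ω => W t ω - W s ω) P = gaussianReal 0 (t - s).toNNReal)
    (ν b : ℝ) (hint : Integrable (fun ω => reflPayoff ν (b + ν * t + W t ω)) P)
    {A : Set Ω} (hA : MeasurableSet[ℱ s] A) :
    ∫ ω in A, reflPayoff ν (b + ν * t + W t ω) ∂P =
      ∫ ω in A, reflKernel ν (t - s) (b + ν * s + W s ω) ∂P := by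
  have hWt : Measurable (W t) := (hadapted t).mono (ℱ.le t) le_rfl
  have hWs : Measurable (W s) := (hadapted s).mono (ℱ.le s) le_rfl
  have hA' : MeasurableSet A := ℱ.le s _ hA
  set U : Ω → ℝ × ℝ := fun ω => (A.indicator (fun _ => (1 : ℝ)) ω, W s ω) with hU
  set V : Ω → ℝ := fun ω => W t ω - W s ω with hV
  have hUs : Measurable[ℱ s] U :=
    Measurable.prodMk (Measurable.indicator (mβ := inferInstance) measurable_const hA) (hadapted s)
  have hUm : Measurable U := hUs.mono (ℱ.le s) le_rfl
  have hVm : Measurable V := hWt.sub hWs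
  have hUV : IndepFun U V P :=
    (indep_of_indep_of_le_right hindep hUs.comap_le).symm
  have hprod := (indepFun_iff_map_prod_eq_prod_map_map hUm.aemeasurable hVm.aemeasurable).1 hUV
  rw [hgauss] at hprod
  set F : (ℝ × ℝ) × ℝ → ℝ := fun p =>
    p.1.1 * reflPayoff ν ((b + ν * s + p.1.2) + (ν * (t - s) + p.2)) with hF
  have hFm : Measurable F := (by fun_prop : Measurable fun p : (ℝ × ℝ) × ℝ => p.1.1).mul
    ((measurable_reflPayoff ν).comp (by fun_prop))
  have hFUV (ω : Ω) : F (U ω, V ω) =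
      A.indicator (fun ω => reflPayoff ν (b + ν * t + W t ω)) ω := by
    by_cases hω : ω ∈ A
    · simp only [hF, hU, hV, indicator_of_mem hω, one_mul]
      congr 1
      ring
    · simp [hF, hU, hV, indicator_of_notMem hω]
  have hFint : Integrable F ((P.map U).prod (gaussianReal 0 (t - s).toNNReal)) := by
    rw [← hprod, integrable_map_measure hFm.aestronglyMeasurable
      (hUm.prodMk hVm).aemeasurable]
    exact (hint.indicator hA').congr (ae_of_all _ fun ω => (hFUV ω).symm)
  have hinner (p : ℝ × ℝ) : ∫ y, F (p, y) ∂gaussianReal 0 (t - s).toNNReal =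
      p.1 * reflKernel ν (t - s) (b + ν * s + p.2) := by
    simp only [hF]
    have hlaw := gaussianReal_map_const_add (μ := 0) (v := (t - s).toNNReal) (ν * (t - s))
    rw [zero_add] at hlaw
    have hm : Measurable fun y => reflPayoff ν (b + ν * s + p.2 + y) :=
      (measurable_reflPayoff ν).comp (measurable_const_add _)
    rw [integral_const_mul, reflKernel, ← hlaw,
      integral_map (by fun_prop) hm.aestronglyMeasurable]
  rw [← integral_indicator hA', ← integral_indicator hA']
  calc ∫ ω, A.indicator (fun ω => reflPayoff ν (b + ν * t + W t ω)) ω ∂P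
      = ∫ ω, F (U ω, V ω) ∂P := by simp_rw [hFUV]
    _ = ∫ p, F p ∂(P.map fun ω => (U ω, V ω)) :=
        (integral_map (hUm.prodMk hVm).aemeasurable hFm.aestronglyMeasurable).symm
    _ = ∫ p, p.1 * reflKernel ν (t - s) (b + ν * s + p.2) ∂(P.map U) := by
        rw [hprod, integral_prod _ hFint]
        simp_rw [hinner]
    _ = ∫ ω, (U ω).1 * reflKernel ν (t - s) (b + ν * s + (U ω).2) ∂P :=
        integral_map hUm.aemeasurable (Measurable.aestronglyMeasurable
          (measurable_fst.mul ((measurable_reflKernel ν _).comp (by fun_prop))))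
    _ = _ := by
        congr 1 with ω
        by_cases hω : ω ∈ A
        · simp [hU, indicator_of_mem hω]
        · simp [hU, indicator_of_notMem hω]

/-- The probability that a Brownian motion with drift `ν` started from `b` is nonpositive at some
point of the grid of mesh `T / (n + 1)` converges to a Gaussian integral. -/
lemma tendsto_measureReal_exists_grid_nonpos (hadapted : Adapted ℱ W)
    (hW0 : ∀ᵐ ω ∂P, W 0 ω = 0)
    (hcont : ∀ᵐ ω ∂P, Continuous (fun t => W t ω))
    (hindep : ∀ s t : ℝ, 0 ≤ s → s ≤ t →
      Indep (MeasurableSpace.comap (fun ω => W t ω - W s ω) inferInstance) (ℱ s) P)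
    (hgauss : ∀ s t : ℝ, 0 ≤ s → s ≤ t →
      Measure.map (fun ω => W t ω - W s ω) P = gaussianReal 0 ((t - s).toNNReal))
    (ν : ℝ) {b T : ℝ} (hb : 0 < b) (hT : 0 < T) :
    Tendsto (fun n : ℕ => P.real {ω | ∃ k < n + 2,
      b + ν * (k * (T / (n + 1))) + W (k * (T / (n + 1))) ω ≤ 0}) atTop
      (𝓝 (reflKernel ν T b)) := by
  have hW (t : ℝ) : Measurable (W t) := (hadapted t).mono (ℱ.le t) le_rfl
  have hlaw := map_eq_gaussianReal_of_increments hW0 hgauss hT.le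
  have hlaw' : P.map (fun ω => ν * T + W T ω) = gaussianReal (ν * T) T.toNNReal := by
    rw [show (fun ω => ν * T + W T ω) = (fun y => ν * T + y) ∘ W T from rfl,
      ← Measure.map_map (by fun_prop) (hW T), hlaw, gaussianReal_map_const_add, zero_add]
  have hm : AEMeasurable (fun ω => ν * T + W T ω) P := ((hW T).const_add _).aemeasurable
  have hgm : Measurable fun y => reflPayoff ν (b + y) :=
    (measurable_reflPayoff ν).comp (measurable_const_add b)
  have hint : Integrable (fun ω => reflPayoff ν (b + ν * T + W T ω)) P := by
    have := integrable_reflPayoff_add ν b (ν * T) T.toNNReal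
    rw [← hlaw', integrable_map_measure hgm.aestronglyMeasurable hm] at this
    simpa only [add_assoc, Function.comp_def] using this
  have hexp : ∫ ω, reflPayoff ν (b + ν * T + W T ω) ∂P = reflKernel ν T b := by
    rw [reflKernel, ← hlaw', integral_map hm hgm.aestronglyMeasurable]
    simp only [add_assoc]
  have hne : ∀ᵐ ω ∂P, b + ν * T + W T ω ≠ 0 := by
    have : NullSingletonClass (gaussianReal 0 T.toNNReal) :=
      nullSingletonClass_gaussianReal (by simpa using hT)
    have h1 : ∀ᵐ y ∂P.map (W T), y ≠ -(b + ν * T) := by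
      rw [hlaw]; exact Measure.ae_ne _ _
    filter_upwards [ae_of_ae_map (hW T).aemeasurable h1] with ω h2 h3
    exact h2 (by linarith)
  set Y : ℝ → Ω → ℝ := fun t ω => b + ν * t + W t ω with hYdef
  set τ : ℕ → ℕ → ℝ := fun n k => k * (T / (n + 1)) with hτ
  have hYF (t : ℝ) : Measurable[ℱ t] (Y t) := (hadapted t).const_add _
  have hY (t : ℝ) : Measurable (Y t) := (hYF t).mono (ℱ.le t) le_rfl
  have hτ0 (n k : ℕ) : 0 ≤ τ n k := by positivity
  have hτmono (n : ℕ) {j k : ℕ} (hjk : j ≤ k) : τ n j ≤ τ n k := by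
    simp only [hτ]; gcongr
  have hτlast (n : ℕ) : τ n (n + 1) = T := by simp only [hτ]; push_cast; field_simp
  set C : ℕ → ℕ → Set Ω := fun n k =>
    {ω | (∀ j < k, 0 < Y (τ n j) ω) ∧ Y (τ n k) ω ≤ 0 ∧ -1 ≤ Y (τ n k) ω} with hC
  have hCF (n k : ℕ) : MeasurableSet[ℱ (τ n k)] (C n k) := by
    have h1 : MeasurableSet[ℱ (τ n k)] {ω | ∀ j < k, 0 < Y (τ n j) ω} := by
      simp only [ofPred_forall]
      refine MeasurableSet.iInter fun j => MeasurableSet.iInter fun hj => ?_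
      exact ℱ.mono (hτmono n hj.le) _ (hYF (τ n j) measurableSet_Ioi)
    exact h1.inter ((hYF _ measurableSet_Iic).inter (hYF _ measurableSet_Ici))
  set ψ : ℕ → ℕ → Ω → ℝ := fun n k ω =>
    reflPayoff ν (Y T ω) - reflKernel ν (T - τ n k) (Y (τ n k) ω) with hψ
  set S : ℕ → Ω → ℝ := fun n ω => ∑ k ∈ Finset.range (n + 2), (C n k).indicator (ψ n k) ω with hS
  set Q : ℕ → Set Ω := fun n => {ω | ∃ k < n + 2, Y (τ n k) ω ≤ 0} with hQ
  have hQm (n : ℕ) : MeasurableSet (Q n) := by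
    simp only [hQ, ofPred_exists, ofPred_and]
    exact MeasurableSet.iUnion fun k => (MeasurableSet.const _).inter (hY _ measurableSet_Iic)
  have hkerm (n k : ℕ) : Measurable fun ω => reflKernel ν (T - τ n k) (Y (τ n k) ω) :=
    (measurable_reflKernel ν _).comp (hY _)
  have hker (n k : ℕ) (hk : k < n + 2) (ω : Ω) (hω : -1 ≤ Y (τ n k) ω ∧ Y (τ n k) ω ≤ 0) :
      reflKernel ν (T - τ n k) (Y (τ n k) ω) ≤ 1 + Real.exp (2 * |ν|) := by
    refine (reflKernel_le ν _ ?_).trans ?_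
    · rw [sub_nonneg, ← hτlast n]; exact hτmono n (by omega)
    · refine add_le_add_right (Real.exp_le_exp.2 ?_) _
      rw [mul_assoc, neg_mul, ← mul_neg]
      refine mul_le_mul_of_nonneg_left ((le_abs_self _).trans ?_) zero_le_two
      rw [abs_neg, abs_mul]
      exact mul_le_of_le_one_right (abs_nonneg _) (abs_le.2 ⟨hω.1, by linarith [hω.2]⟩)
  have hterm (n k : ℕ) (hk : k < n + 2) : Integrable ((C n k).indicator (ψ n k)) P ∧
      ∫ ω, (C n k).indicator (ψ n k) ω ∂P = 0 := by
    have hCm : MeasurableSet (C n k) := ℱ.le _ _ (hCF n k)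
    have h1 : IntegrableOn (fun ω => reflKernel ν (T - τ n k) (Y (τ n k) ω)) (C n k) P := by
      refine Integrable.of_bound (hkerm n k).aestronglyMeasurable (1 + Real.exp (2 * |ν|)) ?_
      filter_upwards [ae_restrict_mem hCm] with ω hω
      rw [Real.norm_of_nonneg (reflKernel_nonneg _ _ _)]
      exact hker n k hk ω ⟨hω.2.2, hω.2.1⟩
    have hτT : τ n k ≤ T := by rw [← hτlast n]; exact hτmono n (by omega)
    rw [integrable_indicator_iff hCm, integral_indicator hCm]
    refine ⟨hint.integrableOn.sub h1, ?_⟩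
    rw [integral_sub hint.integrableOn h1, sub_eq_zero]
    exact setIntegral_reflPayoff_eq_setIntegral_reflKernel hadapted
      (hindep _ _ (hτ0 n k) hτT) (hgauss _ _ (hτ0 n k) hτT) ν b hint (hCF n k)
  have hSint (n : ℕ) : Integrable (S n) P :=
    integrable_finsetSum _ fun k hk => (hterm n k (Finset.mem_range.1 hk)).1
  have hS0 (n : ℕ) : ∫ ω, S n ω ∂P = 0 := by
    simp only [hS]
    rw [integral_finsetSum _ fun k hk => (hterm n k (Finset.mem_range.1 hk)).1]
    exact Finset.sum_eq_zero fun k hk => (hterm n k (Finset.mem_range.1 hk)).2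
  have hSQ (n : ℕ) (ω : Ω) : (S n ω + (Q n).indicator 1 ω = 0 ∧ reflPayoff ν (Y T ω) = 0) ∨
      ∃ k < n + 2, (∀ j < k, 0 < Y (τ n j) ω) ∧ Y (τ n k) ω ≤ 0 ∧
        S n ω + (Q n).indicator 1 ω = (C n k).indicator (ψ n k) ω + 1 := by
    by_cases h : ω ∈ Q n
    · right
      classical
      have hex : ∃ k, k < n + 2 ∧ Y (τ n k) ω ≤ 0 := h
      have hfind := Nat.find_spec hex
      have hmin : ∀ j < Nat.find hex, 0 < Y (τ n j) ω := fun j hj => by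
        by_contra! hle
        exact Nat.find_min hex hj ⟨hj.trans hfind.1, hle⟩
      refine ⟨Nat.find hex, hfind.1, hmin, hfind.2, ?_⟩
      rw [indicator_of_mem h, Pi.one_apply]
      congr 1
      refine Finset.sum_eq_single_of_mem _ (Finset.mem_range.2 hfind.1) fun k _ hne => ?_
      refine indicator_of_notMem (fun hk => ?_) _
      rcases hne.lt_or_gt with hlt | hgt
      · exact absurd hk.2.1 (not_le.2 (hmin k hlt))
      · exact absurd hfind.2 (not_le.2 (hk.1 _ hgt))
    · left
      rw [indicator_of_notMem h, add_zero]
      constructor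
      · exact Finset.sum_eq_zero fun k hk => indicator_of_notMem
          (fun hω => h ⟨k, Finset.mem_range.1 hk, hω.2.1⟩) _
      · refine indicator_of_notMem (fun hT0 => h ⟨n + 1, by omega, ?_⟩) _
        rwa [hτlast]
  have hlim : Tendsto (fun n => ∫ ω, (S n ω + (Q n).indicator 1 ω) ∂P) atTop
      (𝓝 (∫ ω, reflPayoff ν (Y T ω) ∂P)) := by
    refine tendsto_integral_of_dominated_convergence
      (fun ω => reflPayoff ν (Y T ω) + (1 + Real.exp (2 * |ν|)) + 1) (fun n => ?_)
      ((hint.add (integrable_const _)).add (integrable_const _)) (fun n => ?_) ?_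
    · exact ((hSint n).aestronglyMeasurable).add
        (measurable_one.indicator (hQm n)).aestronglyMeasurable
    · refine ae_of_all _ fun ω => ?_
      have hg0 := reflPayoff_nonneg ν (Y T ω)
      have hE := Real.exp_pos (2 * |ν|)
      obtain ⟨h, -⟩ | ⟨k, hk, hpos, hneg, h⟩ := hSQ n ω
      · rw [h, norm_zero]; positivity
      · rw [h, Real.norm_eq_abs]
        by_cases hω : ω ∈ C n k
        · have h1 := hker n k hk ω ⟨hω.2.2, hω.2.1⟩
          have h2 := reflKernel_nonneg ν (T - τ n k) (Y (τ n k) ω)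
          rw [indicator_of_mem hω, abs_le]
          simp only [hψ]
          constructor <;> linarith
        · rw [indicator_of_notMem hω, zero_add, abs_one]
          linarith
    · filter_upwards [hW0, hcont, hne] with ω h0 hc hTne
      have hYc : Continuous fun t => Y t ω := (by fun_prop : Continuous fun t => b + ν * t).add hc
      obtain ⟨δ, hδ, hev⟩ := hYc.eventually_first_nonpos_grid hT
        (by simpa [hYdef, h0] using hb) hTne
      have hbound : Tendsto (fun z => 2 * |z| / √δ + |Real.exp (-2 * ν * z) - 1|) (𝓝 0)
          (𝓝 0) := by
        have : Continuous fun z => 2 * |z| / √δ + |Real.exp (-2 * ν * z) - 1| := by fun_prop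
        simpa using this.tendsto 0
      rw [Metric.tendsto_atTop']
      intro ε hε
      obtain ⟨η, hη, hsmall⟩ := Metric.eventually_nhds_iff.1 (hbound.eventually_lt_const hε)
      obtain ⟨N, hN⟩ := eventually_atTop.1 (hev (min 1 (η / 2)) (by positivity))
      refine ⟨N, fun n hn => ?_⟩
      obtain ⟨h, h'⟩ | ⟨k, hk, hpos, hneg, h⟩ := hSQ n ω
      · rw [h, h', dist_self]; exact hε
      · obtain ⟨h1, h2⟩ := hN n hn.le k (by omega) hpos hneg
        have hω : ω ∈ C n k :=
          ⟨hpos, hneg, (neg_le_neg (min_le_left _ _)).trans h1⟩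
        have hz : |Y (τ n k) ω| < η := by
          rw [abs_of_nonpos hneg]
          have := min_le_right 1 (η / 2)
          have h1' : -min 1 (η / 2) ≤ Y (τ n k) ω := h1
          linarith
        have h2' : δ ≤ T - τ n k := h2
        rw [h, indicator_of_mem hω, Real.dist_eq, ← abs_neg]
        simp only [hψ]
        rw [show -(reflPayoff ν (Y T ω) - reflKernel ν (T - τ n k) (Y (τ n k) ω) + 1 -
          reflPayoff ν (Y T ω)) = reflKernel ν (T - τ n k) (Y (τ n k) ω) - 1 by ring]
        refine (abs_reflKernel_sub_one_le ν _ (hδ.trans_le h2')).trans_lt ?_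
        refine lt_of_le_of_lt ?_ (hsmall (y := Y (τ n k) ω) (by simpa using hz))
        gcongr
  rw [hexp] at hlim
  refine hlim.congr fun n => ?_
  have hQint : Integrable ((Q n).indicator (1 : Ω → ℝ)) P :=
    (integrable_const (1 : ℝ)).indicator (hQm n)
  rw [integral_add (hSint n) hQint, hS0, zero_add,
    integral_indicator_one (hQm n)]

lemma integrable_exp_mul_sInf_and_integral_eq (hadapted : Adapted ℱ W)
    (hW0 : ∀ᵐ ω ∂P, W 0 ω = 0)
    (hcont : ∀ᵐ ω ∂P, Continuous (fun t => W t ω))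
    (hindep : ∀ s t : ℝ, 0 ≤ s → s ≤ t →
      Indep (MeasurableSpace.comap (fun ω => W t ω - W s ω) inferInstance) (ℱ s) P)
    (hgauss : ∀ s t : ℝ, 0 ≤ s → s ≤ t →
      Measure.map (fun ω => W t ω - W s ω) P = gaussianReal 0 ((t - s).toNNReal))
    (ν : ℝ) {c T : ℝ} (hc : 0 < c) (hT : 0 < T) :
    Integrable (fun ω => Real.exp (c * sInf ((fun t => ν * t + W t ω) '' Icc 0 T))) P ∧
      ∫ ω, Real.exp (c * sInf ((fun t => ν * t + W t ω) '' Icc 0 T)) ∂P =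
        1 - ∫ b in Ioi (0 : ℝ), c * Real.exp (-(c * b)) * reflKernel ν T b := by
  have hW (t : ℝ) : Measurable (W t) := (hadapted t).mono (ℱ.le t) le_rfl
  set M : ℕ → Ω → ℝ := fun n ω => (Finset.range (n + 2)).inf' Finset.nonempty_range_add_one
    fun k : ℕ => ν * (k * (T / (n + 1))) + W (k * (T / (n + 1))) ω with hM
  set m : Ω → ℝ := fun ω => sInf ((fun t => ν * t + W t ω) '' Icc 0 T)
  have hMm (n : ℕ) : Measurable (M n) := by
    have : M n = (Finset.range (n + 2)).inf' Finset.nonempty_range_add_one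
        fun (k : ℕ) ω => ν * (k * (T / (n + 1))) + W (k * (T / (n + 1))) ω := by
      ext ω
      simp [hM, Finset.inf'_apply]
    rw [this]
    exact Finset.inf'_induction _ _ (fun _ h₁ _ h₂ => h₁.inf h₂) fun k _ => (hW _).const_add _
  have hM0 : ∀ᵐ ω ∂P, ∀ n, M n ω ≤ 0 := by
    filter_upwards [hW0] with ω h n
    exact (Finset.inf'_le (fun k : ℕ => ν * (k * (T / (n + 1))) + W (k * (T / (n + 1))) ω)
      (Finset.mem_range.2 (Nat.succ_pos _))).trans_eq (by simp [h])
  have hMlim : ∀ᵐ ω ∂P, Tendsto (fun n => M n ω) atTop (𝓝 (m ω)) := by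
    filter_upwards [hcont] with ω h
    exact Continuous.tendsto_inf'_grid_sInf
      ((by fun_prop : Continuous fun t => ν * t).add h) hT
  have hm : AEMeasurable m P :=
    aemeasurable_of_tendsto_metrizable_ae atTop (fun n => (hMm n).aemeasurable) hMlim
  have hm0 : ∀ᵐ ω ∂P, m ω ≤ 0 := by
    filter_upwards [hM0, hMlim] with ω h1 h2
    exact le_of_tendsto' h2 h1
  refine ⟨Integrable.of_bound (hm.const_mul c).exp.aestronglyMeasurable 1 ?_, ?_⟩
  · filter_upwards [hm0] with ω h
    rw [Real.norm_eq_abs, Real.abs_exp, Real.exp_le_one_iff]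
    exact mul_nonpos_of_nonneg_of_nonpos hc.le h
  have hlim1 : Tendsto (fun n => ∫ ω, Real.exp (c * M n ω) ∂P) atTop
      (𝓝 (∫ ω, Real.exp (c * m ω) ∂P)) := by
    refine tendsto_integral_of_dominated_convergence (fun _ => 1) (fun n => by fun_prop)
      (integrable_const _) (fun n => ?_) ?_
    · filter_upwards [hM0] with ω h
      rw [Real.norm_eq_abs, Real.abs_exp, Real.exp_le_one_iff]
      exact mul_nonpos_of_nonneg_of_nonpos hc.le (h n)
    · filter_upwards [hMlim] with ω h
      exact (Real.continuous_exp.tendsto _).comp (h.const_mul c)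
  have hlayer (n : ℕ) : ∫ ω, Real.exp (c * M n ω) ∂P =
      1 - ∫ b in Ioi (0 : ℝ), c * Real.exp (-(c * b)) * P.real {ω | b ≤ -M n ω} := by
    have h := integral_Ioi_exp_mul_measureReal_le P (f := fun ω => -M n ω)
      (hMm n).neg.aemeasurable (by filter_upwards [hM0] with ω h using neg_nonneg.2 (h n)) hc
    simp only [mul_neg, neg_neg] at h
    rw [h, sub_sub_cancel]
  have hlim2 : Tendsto (fun n => ∫ b in Ioi (0 : ℝ),
      c * Real.exp (-(c * b)) * P.real {ω | b ≤ -M n ω}) atTop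
      (𝓝 (∫ b in Ioi (0 : ℝ), c * Real.exp (-(c * b)) * reflKernel ν T b)) := by
    refine tendsto_integral_of_dominated_convergence (fun b => c * Real.exp (-c * b))
      (fun n => ?_) ((integrableOn_exp_mul_Ioi (neg_lt_zero.2 hc) 0).const_mul c)
      (fun n => ae_of_all _ fun b => ?_) ?_
    · have hanti : Antitone fun b : ℝ => P.real {ω | b ≤ -M n ω} := fun b b' hb =>
        measureReal_mono fun a (ha : b' ≤ -M n a) => hb.trans ha
      have : Measurable fun b : ℝ => c * Real.exp (-(c * b)) * P.real {ω | b ≤ -M n ω} :=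
        Measurable.mul (by fun_prop) hanti.measurable
      exact this.aestronglyMeasurable
    · rw [Real.norm_of_nonneg (by positivity), neg_mul]
      exact mul_le_of_le_one_right (by positivity) measureReal_le_one
    · filter_upwards [ae_restrict_mem measurableSet_Ioi] with b hb
      refine (Tendsto.congr (fun n => ?_) (tendsto_measureReal_exists_grid_nonpos hadapted hW0
        hcont hindep hgauss ν hb hT)).const_mul _
      congr 1
      ext ω
      simp only [mem_ofPred_eq, le_neg, hM, Finset.inf'_le_iff, Finset.mem_range]
      refine exists_congr fun k => and_congr_right fun _ => ?_
      constructor <;> intro h <;> linarith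
  exact tendsto_nhds_unique hlim1 ((hlim2.const_sub 1).congr fun n => (hlayer n).symm)

end BrownianMotion

lemma integral_Ioi_exp_mul_reflKernel {ν c T : ℝ} (hc : 0 < c) (hcν : 0 < c + 2 * ν) (hT : 0 < T) :
    ∫ b in Ioi (0 : ℝ), c * Real.exp (-(c * b)) * reflKernel ν T b =
      1 - (Real.exp (c * (ν * T) + c ^ 2 * T / 2) * stdNormalCDF (-(ν + c) * √T) +
        stdNormalCDF (ν * √T)) + c / (c + 2 * ν) *
      (1 - (Real.exp (c * (ν * T) + c ^ 2 * T / 2) * stdNormalCDF (-(ν + c) * √T) +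
        stdNormalCDF (-ν * √T))) := by
  have hv : T.toNNReal ≠ 0 := by simpa using hT
  have hTT : T / √T = √T := Real.div_sqrt
  have hlayer (m d : ℝ) (hd : 0 < d) : ∫ b in Ioi (0 : ℝ), d * Real.exp (-(d * b)) *
      (gaussianReal m T.toNNReal).real {y | b ≤ max (-y) 0} =
        1 - (Real.exp (d * m + d ^ 2 * T / 2) * stdNormalCDF ((-m - d * T) / √T) +
          stdNormalCDF (m / √T)) := by
    have h := integral_exp_neg_mul_max_gaussianReal m d hv
    rw [Real.coe_toNNReal T hT.le] at h
    rw [← h]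
    exact integral_Ioi_exp_mul_measureReal_le _ (by fun_prop)
      (ae_of_all _ fun y => le_max_right _ _) hd
  have hint (m d : ℝ) (hd : 0 < d) : IntegrableOn (fun b => d * Real.exp (-(d * b)) *
      (gaussianReal m T.toNNReal).real {y | b ≤ max (-y) 0}) (Ioi 0) := by
    have hanti : Antitone fun b : ℝ => (gaussianReal m T.toNNReal).real {y | b ≤ max (-y) 0} :=
      fun b b' hb => measureReal_mono fun a (ha : b' ≤ max (-a) 0) => hb.trans ha
    have hmeas : Measurable fun b : ℝ => d * Real.exp (-(d * b)) *
        (gaussianReal m T.toNNReal).real {y | b ≤ max (-y) 0} :=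
      Measurable.mul (by fun_prop) hanti.measurable
    refine Integrable.mono' ((integrableOn_exp_mul_Ioi (neg_lt_zero.2 hd) 0).const_mul d)
      hmeas.aestronglyMeasurable (ae_of_all _ fun b => ?_)
    rw [Real.norm_of_nonneg (by positivity), neg_mul]
    exact mul_le_of_le_one_right (by positivity) measureReal_le_one
  have hker : EqOn (fun b => c * Real.exp (-(c * b)) * reflKernel ν T b)
      (fun b => c * Real.exp (-(c * b)) *
        (gaussianReal (ν * T) T.toNNReal).real {y | b ≤ max (-y) 0} + c / (c + 2 * ν) *
        ((c + 2 * ν) * Real.exp (-((c + 2 * ν) * b)) *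
          (gaussianReal (-(ν * T)) T.toNNReal).real {y | b ≤ max (-y) 0})) (Ioi 0) := by
    intro b hb
    have hset : {y : ℝ | b ≤ max (-y) 0} = Iic (-b) := by
      ext y
      simp only [mem_ofPred_eq, le_max_iff, mem_Iic, not_le.2 (mem_Ioi.1 hb), or_false]
      exact le_neg
    simp only
    rw [hset, gaussianReal_real_Iic _ hv, gaussianReal_real_Iic _ hv, reflKernel_eq _ _ hT,
      Real.coe_toNNReal T hT.le, sub_neg_eq_add,
      show -((c + 2 * ν) * b) = -(c * b) + -2 * ν * b by ring, Real.exp_add]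
    linear_combination -(Real.exp (-(c * b)) * Real.exp (-2 * ν * b) *
      stdNormalCDF ((-b + ν * T) / √T)) * div_mul_cancel₀ c hcν.ne'
  rw [setIntegral_congr_fun measurableSet_Ioi hker, integral_add (hint _ _ hc)
    ((hint _ _ hcν).const_mul _), integral_const_mul, hlayer _ _ hc, hlayer _ _ hcν,
    show (c + 2 * ν) * -(ν * T) + (c + 2 * ν) ^ 2 * T / 2 = c * (ν * T) + c ^ 2 * T / 2 by ring,
    show (-(ν * T) - c * T) / √T = -(ν + c) * √T by
      rw [show -(ν * T) - c * T = -(ν + c) * T by ring, mul_div_assoc, hTT],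
    show (- -(ν * T) - (c + 2 * ν) * T) / √T = -(ν + c) * √T by
      rw [show - -(ν * T) - (c + 2 * ν) * T = -(ν + c) * T by ring, mul_div_assoc, hTT],
    show ν * T / √T = ν * √T by rw [mul_div_assoc, hTT],
    show -(ν * T) / √T = -ν * √T by rw [← neg_mul, mul_div_assoc, hTT]]

/-- Closed form of the floating-strike lookback call price at time `0`:
if `W` is a standard Brownian motion and `X_t = x·exp((r − σ²/2)t + σW_t)`, then
`e^{−rT}·E[X_T − inf_{0≤t≤T} X_t]
  = x·Φ(a₁) − x·e^{−rT}·Φ(a₂) − x·(σ²/(2r))·(Φ(−a₁) − e^{−rT}·Φ(−a₃))`. -/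
theorem stmt_12 {Ω : Type*} {m0 : MeasurableSpace Ω} (P : Measure Ω) [IsProbabilityMeasure P]
    (ℱ : Filtration ℝ m0) (W : ℝ → Ω → ℝ)
    (x σ r T : ℝ) (hx : 0 < x) (hσ : 0 < σ) (hr : 0 < r) (hT : 0 < T)
    (hmeas : Measurable (fun p : ℝ × Ω => W p.1 p.2))
    (hadapted : Adapted ℱ W)
    (hW0 : ∀ᵐ ω ∂P, W 0 ω = 0)
    (hcont : ∀ᵐ ω ∂P, Continuous (fun t => W t ω))
    (hindep : ∀ s t : ℝ, 0 ≤ s → s ≤ t →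
      Indep (MeasurableSpace.comap (fun ω => W t ω - W s ω) inferInstance) (ℱ s) P)
    (hgauss : ∀ s t : ℝ, 0 ≤ s → s ≤ t →
      Measure.map (fun ω => W t ω - W s ω) P = gaussianReal 0 ((t - s).toNNReal))
    (X : ℝ → Ω → ℝ)
    (hX : ∀ t ω, X t ω = x * Real.exp ((r - σ ^ 2 / 2) * t + σ * W t ω)) :
    Real.exp (-(r * T)) *
        ∫ ω, (X T ω - sInf ((fun t => X t ω) '' Set.Icc (0 : ℝ) T)) ∂P =
      x * stdNormalCDF ((r + σ ^ 2 / 2) * T / (σ * Real.sqrt T)) -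
        x * Real.exp (-(r * T)) *
          stdNormalCDF ((r + σ ^ 2 / 2) * T / (σ * Real.sqrt T) - σ * Real.sqrt T) -
        x * (σ ^ 2 / (2 * r)) *
          (stdNormalCDF (-((r + σ ^ 2 / 2) * T / (σ * Real.sqrt T))) -
            Real.exp (-(r * T)) *
              stdNormalCDF (-((r + σ ^ 2 / 2) * T / (σ * Real.sqrt T) -
                (2 * r / σ) * Real.sqrt T))) := by
  have hW (t : ℝ) : Measurable (W t) := (hadapted t).mono (ℱ.le t) le_rfl
  set ν : ℝ := (r - σ ^ 2 / 2) / σ with hν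
  have hσν : σ * ν = r - σ ^ 2 / 2 := by rw [hν]; field_simp
  have hcν : σ + 2 * ν = 2 * r / σ := by rw [hν]; field_simp; ring
  have hsT : 0 < √T := Real.sqrt_pos.2 hT
  have hsT2 : √T * √T = T := Real.mul_self_sqrt hT.le
  obtain ⟨hint, hinf⟩ := integrable_exp_mul_sInf_and_integral_eq hadapted hW0 hcont hindep
    hgauss ν hσ hT
  rw [integral_Ioi_exp_mul_reflKernel hσ (by rw [hcν]; positivity) hT] at hinf
  have hlaw := map_eq_gaussianReal_of_increments hW0 hgauss hT.le
  have hXT : (fun ω => X T ω) =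
      fun ω => x * Real.exp ((r - σ ^ 2 / 2) * T) * Real.exp (σ * W T ω) := by
    ext ω
    rw [hX, Real.exp_add, mul_assoc]
  have hXint : Integrable (fun ω => X T ω) P := by
    have h := integrable_exp_mul_gaussianReal (μ := 0) (v := T.toNNReal) σ
    rw [← hlaw, integrable_map_measure (by fun_prop) (hW T).aemeasurable] at h
    rw [hXT]
    exact h.const_mul _
  have hXexp : ∫ ω, X T ω ∂P = x * Real.exp (r * T) := by
    have h := mgf_gaussianReal hlaw σ
    rw [mgf, Real.coe_toNNReal T hT.le] at h
    rw [hXT, integral_const_mul, h, mul_assoc, ← Real.exp_add]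
    congr 2
    ring
  have hsInf : ∀ᵐ ω ∂P, sInf ((fun t => X t ω) '' Icc (0 : ℝ) T) =
      x * Real.exp (σ * sInf ((fun t => ν * t + W t ω) '' Icc 0 T)) := by
    filter_upwards [hcont] with ω hω
    have hB : Continuous fun t => ν * t + W t ω :=
      (by fun_prop : Continuous fun t => ν * t).add hω
    have hmono : Monotone fun y => x * Real.exp (σ * y) := fun y z hyz => by
      simp only; gcongr
    have h := hmono.map_csInf_of_continuousAt (A := (fun t => ν * t + W t ω) '' Icc 0 T)
      (Continuous.continuousAt (by fun_prop)) ((nonempty_Icc.2 hT.le).image _)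
      (isCompact_Icc.image hB).bddBelow
    rw [h, image_image]
    congr 2
    ext t
    rw [hX, mul_add, ← mul_assoc, hσν]
  have ha1 : (r + σ ^ 2 / 2) * T / (σ * √T) = (ν + σ) * √T := by
    rw [div_eq_iff (by positivity), show (ν + σ) * √T * (σ * √T) =
      (σ * ν + σ ^ 2) * (√T * √T) by ring, hσν, hsT2]
    ring
  have ha3 : -((ν + σ) * √T - 2 * r / σ * √T) = ν * √T := by rw [← hcν]; ring
  rw [integral_congr_ae (g := fun ω => X T ω -
      x * Real.exp (σ * sInf ((fun t => ν * t + W t ω) '' Icc 0 T))) (by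
        filter_upwards [hsInf] with ω h
        rw [h]), integral_sub hXint (hint.const_mul x), integral_const_mul, hXexp, hinf, ha1, ha3,
    show (ν + σ) * √T - σ * √T = ν * √T by ring, hcν,
    show σ * (ν * T) + σ ^ 2 * T / 2 = r * T by rw [← mul_assoc, hσν]; ring, neg_mul, neg_mul,
    stdNormalCDF_neg, stdNormalCDF_neg, Real.exp_neg,
    show σ / (2 * r / σ) = σ ^ 2 / (2 * r) by field_simp]
  have hE := Real.exp_ne_zero (r * T)
  field_simp
  ring
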